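/- (Bound-preserving property of a forward-Euler cell-average update with Lax–Friedrichs flux.) Assume v_min ≥ 0. Let L ≥ 2 be an integer, and let ω_1, …, ω_L be positive reals with ω_1 + ⋯ + ω_L = 1 and ω_1 = ω_L. Let U_1, …, U_L ∈ Ω and U⁻, U⁺ ∈ Ω, and set Ū := Σ_{ℓ=1}^{L} ω_ℓ U_ℓ. Let Δt, Δx > 0 and let α > 0 satisfy α > α_max(Ua, Ub) for every ordered pair (Ua, Ub) of states taken from {U⁻, U_1, U_L, U⁺}, and suppose λ := α·Δt/Δx ≤ ω_1. Then the updated cell average Ū* := Ū + (Δt/Δx)·[F̂(U⁻, U_1) − F̂(U_L, U⁺)] belongs to Ω, where F̂(Ua,Ub) := ½[F(Ua) + F(Ub) − α(Ub − Ua)] is the Lax–Friedrichs numerical flux. -/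

import Mathlib

noncomputable def press (vref γ κ ρ z : ℝ) : ℝ :=
  if 0 < γ then vref / γ * z ^ κ * ρ ^ (γ - κ) else vref * Real.log ρ

noncomputable def pRho (vref γ κ ρ z : ℝ) : ℝ :=
  if 0 < γ then vref / γ * (γ - κ) * z ^ κ * ρ ^ (γ - κ - 1) else vref / ρ

noncomputable def pZ (vref γ κ ρ z : ℝ) : ℝ :=
  if 0 < γ then vref / γ * κ * z ^ (κ - 1) * ρ ^ (γ - κ) else 0

noncomputable def vel (vref γ κ : ℝ) (U : ℝ × ℝ × ℝ) : ℝ :=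
  U.2.1 / U.1 - press vref γ κ U.1 U.2.2

noncomputable def flux (vref γ κ : ℝ) (U : ℝ × ℝ × ℝ) : ℝ × ℝ × ℝ :=
  vel vref γ κ U • U

noncomputable def sfun (vref γ κ ρ z : ℝ) : ℝ :=
  ρ ^ 2 * pRho vref γ κ ρ z + ρ * z * pZ vref γ κ ρ z

def dot3 (a b : ℝ × ℝ × ℝ) : ℝ := a.1 * b.1 + a.2.1 * b.2.1 + a.2.2 * b.2.2

noncomputable def nvec (vref γ κ vmin ρ z : ℝ) : ℝ × ℝ × ℝ :=
  (-(vmin + press vref γ κ ρ z + ρ * pRho vref γ κ ρ z), 1, -(ρ * pZ vref γ κ ρ z))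

noncomputable def abar (vref γ κ : ℝ) (U : ℝ × ℝ × ℝ) : ℝ :=
  vel vref γ κ U + |U.1 * pRho vref γ κ U.1 U.2.2 + U.2.2 * pZ vref γ κ U.1 U.2.2|

noncomputable def astd (vref γ κ : ℝ) (Uh Uc : ℝ × ℝ × ℝ) : ℝ :=
  max (abar vref γ κ Uh) (abar vref γ κ Uc)

noncomputable def rho1 (Uh Uc : ℝ × ℝ × ℝ) : ℝ := (Uh.1 + Uc.1) / 2

noncomputable def rho2 (vref γ κ : ℝ) (Uh Uc : ℝ × ℝ × ℝ) : ℝ :=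
  rho1 Uh Uc + (Uh.1 * vel vref γ κ Uh - Uc.1 * vel vref γ κ Uc) / (2 * astd vref γ κ Uh Uc)

noncomputable def zet1 (Uh Uc : ℝ × ℝ × ℝ) : ℝ := (Uh.2.2 + Uc.2.2) / 2

noncomputable def zet2 (vref γ κ : ℝ) (Uh Uc : ℝ × ℝ × ℝ) : ℝ :=
  zet1 Uh Uc + (Uh.2.2 * vel vref γ κ Uh - Uc.2.2 * vel vref γ κ Uc) / (2 * astd vref γ κ Uh Uc)

noncomputable def sbar (vref γ κ : ℝ) (Uh Uc : ℝ × ℝ × ℝ) : ℝ :=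
  sSup ((fun q : ℝ × ℝ => sfun vref γ κ q.1 q.2) ''
    (Set.Icc (min (rho1 Uh Uc) (rho2 vref γ κ Uh Uc)) (max (rho1 Uh Uc) (rho2 vref γ κ Uh Uc)) ×ˢ
     Set.Icc (min (zet1 Uh Uc) (zet2 vref γ κ Uh Uc)) (max (zet1 Uh Uc) (zet2 vref γ κ Uh Uc))))

noncomputable def amax (vref γ κ : ℝ) (Uh Uc : ℝ × ℝ × ℝ) : ℝ :=
  max (astd vref γ κ Uh Uc)
    (max (|vel vref γ κ Uh| + sbar vref γ κ Uh Uc / Uh.1)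
         (|vel vref γ κ Uc| + sbar vref γ κ Uh Uc / Uc.1))

noncomputable def SGLF (vref γ κ α : ℝ) (U1 U2 : ℝ × ℝ × ℝ) : ℝ × ℝ × ℝ :=
  (1/2 : ℝ) • (U1 + α⁻¹ • flux vref γ κ U1 + U2 - α⁻¹ • flux vref γ κ U2)

/-- The bound-preserving set of states, with `w = y / ρ` and `c = z / ρ`. -/
def admissible (vref γ κ vmin wmin wmax cmin cmax : ℝ) : Set (ℝ × ℝ × ℝ) :=
  {U : ℝ × ℝ × ℝ | 0 < U.1 ∧ 0 < U.2.2 ∧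
        wmin ≤ U.2.1 / U.1 ∧ U.2.1 / U.1 ≤ wmax ∧ vmin ≤ vel vref γ κ U ∧
        cmin ≤ U.2.2 / U.1 ∧ U.2.2 / U.1 ≤ cmax}

section Pressure

variable {vref γ κ ρ z r x : ℝ}

lemma press_of_pos (hγ : 0 < γ) : press vref γ κ ρ z = vref / γ * z ^ κ * ρ ^ (γ - κ) :=
  if_pos hγ

lemma mul_pRho_of_pos (hγ : 0 < γ) (hρ : 0 < ρ) :
    ρ * pRho vref γ κ ρ z = (γ - κ) * press vref γ κ ρ z := by
  rw [pRho, press, if_pos hγ, if_pos hγ, Real.rpow_sub_one hρ.ne']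
  field_simp

lemma mul_pZ_of_pos (hγ : 0 < γ) (hz : 0 < z) :
    z * pZ vref γ κ ρ z = κ * press vref γ κ ρ z := by
  rw [pZ, press, if_pos hγ, if_pos hγ, Real.rpow_sub_one hz.ne']
  field_simp

lemma press_pos (hv : 0 < vref) (hγ : 0 < γ) (hρ : 0 < ρ) (hz : 0 < z) :
    0 < press vref γ κ ρ z := by
  rw [press_of_pos hγ]
  positivity

lemma mul_pRho_add_mul_pZ_pos (hv : 0 < vref) (hγ : 0 ≤ γ) (hρ : 0 < ρ) (hz : 0 < z) :
    0 < ρ * pRho vref γ κ ρ z + z * pZ vref γ κ ρ z := by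
  rcases hγ.eq_or_lt with rfl | hγ
  · simp only [pRho, pZ, lt_irrefl, if_false]
    rw [mul_div_cancel₀ _ hρ.ne']
    linarith
  · rw [mul_pRho_of_pos hγ hρ, mul_pZ_of_pos hγ hz]
    nlinarith [mul_pos hγ (press_pos (κ := κ) hv hγ hρ hz)]

lemma vel_lt_abar {U : ℝ × ℝ × ℝ} (hv : 0 < vref) (hγ : 0 ≤ γ) (hρ : 0 < U.1) (hz : 0 < U.2.2) :
    vel vref γ κ U < abar vref γ κ U :=
  lt_add_of_pos_right _ (abs_pos.mpr (mul_pRho_add_mul_pZ_pos hv hγ hρ hz).ne')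

lemma sfun_pos (hv : 0 < vref) (hγ : 0 ≤ γ) (hρ : 0 < ρ) (hz : 0 < z) :
    0 < sfun vref γ κ ρ z := by
  have h := mul_pos hρ (mul_pRho_add_mul_pZ_pos (κ := κ) hv hγ hρ hz)
  rw [sfun]
  linarith

lemma continuousOn_sfun :
    ContinuousOn (fun q : ℝ × ℝ => sfun vref γ κ q.1 q.2) {q | 0 < q.1 ∧ 0 < q.2} := by
  have h1 (e : ℝ) : ContinuousOn (fun q : ℝ × ℝ => q.1 ^ e) {q | 0 < q.1 ∧ 0 < q.2} :=
    continuousOn_fst.rpow_const fun q hq => Or.inl hq.1.ne'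
  have h2 (e : ℝ) : ContinuousOn (fun q : ℝ × ℝ => q.2 ^ e) {q | 0 < q.1 ∧ 0 < q.2} :=
    continuousOn_snd.rpow_const fun q hq => Or.inl hq.2.ne'
  have h3 : ContinuousOn (fun q : ℝ × ℝ => vref / q.1) {q | 0 < q.1 ∧ 0 < q.2} :=
    continuousOn_const.div continuousOn_fst fun q hq => hq.1.ne'
  have h4 := h1 (γ - κ - 1)
  have h5 := h1 (γ - κ)
  have h6 := h2 κ
  have h7 := h2 (κ - 1)
  by_cases hγ : 0 < γ
  · simp only [sfun, pRho, pZ, if_pos hγ]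
    fun_prop
  · simp only [sfun, pRho, pZ, if_neg hγ]
    fun_prop

/-- Weighted AM-GM in the form of the tangent inequality of `(t, u) ↦ u ^ κ * t ^ (γ - κ + 1)`
at `(1, 1)`. -/
lemma tangent_le_rpow_mul_rpow {t u : ℝ} (hγ : 0 ≤ γ) (hκ : γ + 1 ≤ κ) (ht : 0 < t) (hu : 0 < u) :
    κ * u + (γ - κ + 1) * t - γ ≤ u ^ κ * t ^ (γ - κ + 1) := by
  have hκ0 : 0 < κ := by linarith
  have h := Real.geom_mean_le_arith_mean3_weighted (w₁ := 1 / κ) (w₂ := (κ - γ - 1) / κ)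
    (w₃ := γ / κ) (p₁ := u ^ κ * t ^ (γ - κ + 1)) (p₂ := t) (p₃ := 1) (by positivity)
    (div_nonneg (by linarith) hκ0.le) (by positivity) (by positivity) ht.le zero_le_one
    (by field_simp; ring)
  have hgm : (u ^ κ * t ^ (γ - κ + 1)) ^ (1 / κ) * t ^ ((κ - γ - 1) / κ) * 1 ^ (γ / κ) = u := by
    rw [Real.mul_rpow (by positivity) (by positivity), ← Real.rpow_mul hu.le,
      ← Real.rpow_mul ht.le, Real.one_rpow, mul_one, mul_assoc, ← Real.rpow_add ht,
      mul_one_div_cancel hκ0.ne', Real.rpow_one,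
      show (γ - κ + 1) * (1 / κ) + (κ - γ - 1) / κ = 0 by ring, Real.rpow_zero, mul_one]
  rw [hgm] at h
  have h' := mul_le_mul_of_nonneg_left h hκ0.le
  field_simp at h'
  linarith

/-- Convexity of `(ρ, z) ↦ ρ * p(ρ, z)`, as a tangent plane inequality at `(r, x)`. -/
lemma tangent_le_mul_press (hv : 0 < vref) (hγ : 0 ≤ γ) (hκ : γ + 1 ≤ κ) (hρ : 0 < ρ) (hz : 0 < z)
    (hr : 0 < r) (hx : 0 < x) :
    (press vref γ κ r x + r * pRho vref γ κ r x) * ρ + r * pZ vref γ κ r x * z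
      - sfun vref γ κ r x ≤ ρ * press vref γ κ ρ z := by
  rcases hγ.eq_or_lt with rfl | hγ
  · have h := Real.log_le_sub_one_of_pos (div_pos hr hρ)
    rw [Real.log_div hr.ne' hρ.ne'] at h
    have h' := mul_le_mul_of_nonneg_left h (mul_pos hv hρ).le
    simp only [press, pRho, pZ, sfun, lt_irrefl, if_false]
    field_simp at h' ⊢
    nlinarith
  · have hP := press_pos (κ := κ) hv hγ hr hx
    have h := mul_le_mul_of_nonneg_left
      (tangent_le_rpow_mul_rpow hγ.le hκ (div_pos hρ hr) (div_pos hz hx)) (mul_pos hr hP).le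
    have hh : r * press vref γ κ r x * ((z / x) ^ κ * (ρ / r) ^ (γ - κ + 1))
        = ρ * press vref γ κ ρ z := by
      rw [Real.div_rpow hz.le hx.le, Real.div_rpow hρ.le hr.le, Real.rpow_add_one hρ.ne',
        Real.rpow_add_one hr.ne', press_of_pos hγ, press_of_pos hγ]
      field_simp
    rw [hh] at h
    have hZ : pZ vref γ κ r x = κ * press vref γ κ r x / x := by
      rw [← mul_pZ_of_pos hγ hx]
      field_simp
    have hs : sfun vref γ κ r x = γ * (r * press vref γ κ r x) := by
      have h1 := mul_pRho_of_pos (vref := vref) (κ := κ) (z := x) hγ hr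
      have h2 := mul_pZ_of_pos (vref := vref) (κ := κ) (ρ := r) hγ hx
      rw [sfun]
      linear_combination r * h1 + r * h2
    rw [hs, hZ, mul_pRho_of_pos hγ hr]
    refine le_trans (le_of_eq ?_) h
    field_simp
    ring

end Pressure

section Admissible

variable {vref γ κ vmin wmin wmax cmin cmax : ℝ}

/-- The affine functionals supporting the constraint `vmin ≤ v`. -/
lemma mul_vel_sub_le_dot3 {U : ℝ × ℝ × ℝ} {r x : ℝ} (hv : 0 < vref) (hγ : 0 ≤ γ)
    (hκ : γ + 1 ≤ κ) (hρ : 0 < U.1) (hz : 0 < U.2.2) (hr : 0 < r) (hx : 0 < x) :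
    U.1 * (vel vref γ κ U - vmin) ≤ dot3 U (nvec vref γ κ vmin r x) + sfun vref γ κ r x := by
  have h := tangent_le_mul_press hv hγ hκ hρ hz hr hx
  have hy : U.1 * (U.2.1 / U.1) = U.2.1 := mul_div_cancel₀ _ hρ.ne'
  simp only [vel, dot3, nvec]
  nlinarith

lemma dot3_nvec_self {U : ℝ × ℝ × ℝ} (hρ : 0 < U.1) :
    dot3 U (nvec vref γ κ vmin U.1 U.2.2) + sfun vref γ κ U.1 U.2.2 =
      U.1 * (vel vref γ κ U - vmin) := by
  have hy : U.1 * (U.2.1 / U.1) = U.2.1 := mul_div_cancel₀ _ hρ.ne'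
  simp only [vel, dot3, nvec, sfun]
  linear_combination -hy

lemma le_vel_of_dot3_nonneg {U : ℝ × ℝ × ℝ} (hρ : 0 < U.1)
    (h : 0 ≤ dot3 U (nvec vref γ κ vmin U.1 U.2.2) + sfun vref γ κ U.1 U.2.2) :
    vmin ≤ vel vref γ κ U := by
  rw [dot3_nvec_self hρ] at h
  exact sub_nonneg.mp (nonneg_of_mul_nonneg_right h hρ)

/-- Every constraint except the lower bound on `v` cuts out a convex cone. -/
lemma smul_add_smul_mem_admissible {U V : ℝ × ℝ × ℝ} {a b : ℝ}
    (hU : U ∈ admissible vref γ κ vmin wmin wmax cmin cmax)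
    (hV : V ∈ admissible vref γ κ vmin wmin wmax cmin cmax) (ha : 0 < a) (hb : 0 < b)
    (hvel : 0 < (a • U + b • V).1 → 0 < (a • U + b • V).2.2 →
      0 ≤ dot3 (a • U + b • V) (nvec vref γ κ vmin (a • U + b • V).1 (a • U + b • V).2.2)
        + sfun vref γ κ (a • U + b • V).1 (a • U + b • V).2.2) :
    a • U + b • V ∈ admissible vref γ κ vmin wmin wmax cmin cmax := by
  obtain ⟨hρ, hz, hw1, hw2, -, hc1, hc2⟩ := hU
  obtain ⟨hρ', hz', hw1', hw2', -, hc1', hc2'⟩ := hV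
  rw [le_div_iff₀ ‹_›] at hw1 hc1 hw1' hc1'
  rw [div_le_iff₀ ‹_›] at hw2 hc2 hw2' hc2'
  have hρs : 0 < (a • U + b • V).1 := by
    simp only [Prod.fst_add, Prod.smul_fst, smul_eq_mul]
    positivity
  have hzs : 0 < (a • U + b • V).2.2 := by
    simp only [Prod.snd_add, Prod.smul_snd, smul_eq_mul]
    positivity
  refine ⟨hρs, hzs, ?_, ?_, le_vel_of_dot3_nonneg hρs (hvel hρs hzs), ?_, ?_⟩
  all_goals
    first | rw [le_div_iff₀ hρs] | rw [div_le_iff₀ hρs]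
    simp only [Prod.fst_add, Prod.snd_add, Prod.smul_fst, Prod.smul_snd, smul_eq_mul]
    nlinarith

lemma dot3_smul_add_smul (a b : ℝ) (U V n : ℝ × ℝ × ℝ) :
    dot3 (a • U + b • V) n = a * dot3 U n + b * dot3 V n := by
  simp only [dot3, Prod.fst_add, Prod.snd_add, Prod.smul_fst, Prod.smul_snd, smul_eq_mul]
  ring

lemma convex_admissible (hv : 0 < vref) (hγ : 0 ≤ γ) (hκ : γ + 1 ≤ κ) :
    Convex ℝ (admissible vref γ κ vmin wmin wmax cmin cmax) := by
  rw [convex_iff_forall_pos]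
  intro U hU V hV a b ha hb hab
  refine smul_add_smul_mem_admissible hU hV ha hb fun hρs hzs => ?_
  obtain ⟨hρ, hz, -, -, hvel, -, -⟩ := hU
  obtain ⟨hρ', hz', -, -, hvel', -, -⟩ := hV
  have h1 := (mul_nonneg hρ.le (sub_nonneg.mpr hvel)).trans
    (mul_vel_sub_le_dot3 hv hγ hκ hρ hz hρs hzs)
  have h2 := (mul_nonneg hρ'.le (sub_nonneg.mpr hvel')).trans
    (mul_vel_sub_le_dot3 hv hγ hκ hρ' hz' hρs hzs)
  rw [dot3_smul_add_smul]
  linear_combination a * h1 + b * h2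
    + sfun vref γ κ (a • U + b • V).1 (a • U + b • V).2.2 * hab

lemma add_div_mem_Icc_min_max {a d α β : ℝ} (hβ : 0 < β) (hα : β ≤ α) :
    a + d / (2 * α) ∈ Set.Icc (min a (a + d / (2 * β))) (max a (a + d / (2 * β))) := by
  have hα0 := hβ.trans_le hα
  rcases le_total 0 d with hd | hd
  · have h0 : 0 ≤ d / (2 * α) := by positivity
    have h1 : d / (2 * α) ≤ d / (2 * β) := by gcongr
    exact ⟨(min_le_left _ _).trans (by linarith), le_max_of_le_right (by linarith)⟩
  · have h0 : 0 ≤ -d / (2 * α) := div_nonneg (by linarith) (by positivity)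
    have h1 : -d / (2 * α) ≤ -d / (2 * β) := by gcongr; linarith
    rw [neg_div] at h0 h1
    rw [neg_div] at h1
    exact ⟨(min_le_right _ _).trans (by linarith), le_max_of_le_left (by linarith)⟩

lemma mean_add_flux_pos {a b va vb α : ℝ} (ha : 0 < a) (hb : 0 < b) (hva : 0 ≤ va)
    (hα : 0 < α) (hvb : vb < α) :
    0 < (a + b) / 2 + (a * va - b * vb) / (2 * α) := by
  have h : (a + b) / 2 + (a * va - b * vb) / (2 * α)
      = (a * (α + va) + b * (α - vb)) / (2 * α) := by
    field_simp
    ring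
  rw [h]
  have := sub_pos.mpr hvb
  positivity

lemma SGLF_fst {α : ℝ} {U V : ℝ × ℝ × ℝ} (hα : α ≠ 0) :
    (SGLF vref γ κ α U V).1 =
      rho1 U V + (U.1 * vel vref γ κ U - V.1 * vel vref γ κ V) / (2 * α) := by
  simp only [SGLF, flux, rho1, Prod.fst_add, Prod.fst_sub, Prod.smul_fst, smul_eq_mul]
  field_simp
  ring

lemma SGLF_snd_snd {α : ℝ} {U V : ℝ × ℝ × ℝ} (hα : α ≠ 0) :
    (SGLF vref γ κ α U V).2.2 =
      zet1 U V + (U.2.2 * vel vref γ κ U - V.2.2 * vel vref γ κ V) / (2 * α) := by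
  simp only [SGLF, flux, zet1, Prod.snd_add, Prod.snd_sub, Prod.smul_snd, smul_eq_mul]
  field_simp
  ring

lemma SGLF_eq_smul_add_smul (α : ℝ) (U V : ℝ × ℝ × ℝ) :
    SGLF vref γ κ α U V =
      ((1 + vel vref γ κ U / α) / 2) • U + ((1 - vel vref γ κ V / α) / 2) • V := by
  simp only [SGLF, flux]
  match_scalars <;> ring

lemma sfun_SGLF_le_sbar {α : ℝ} {U V : ℝ × ℝ × ℝ} (hρ : 0 < U.1) (hz : 0 < U.2.2)
    (hρ' : 0 < V.1) (hz' : 0 < V.2.2) (hU : 0 ≤ vel vref γ κ U)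
    (hstd : 0 < astd vref γ κ U V) (hV : vel vref γ κ V < astd vref γ κ U V)
    (hα : astd vref γ κ U V ≤ α) :
    sfun vref γ κ (SGLF vref γ κ α U V).1 (SGLF vref γ κ α U V).2.2 ≤ sbar vref γ κ U V := by
  have hα0 := (hstd.trans_le hα).ne'
  refine le_csSup ?_ ⟨((SGLF vref γ κ α U V).1, (SGLF vref γ κ α U V).2.2), ⟨?_, ?_⟩, rfl⟩
  · refine ((isCompact_Icc.prod isCompact_Icc).image_of_continuousOn
      (continuousOn_sfun.mono ?_)).bddAbove
    rintro q ⟨hq1, hq2⟩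
    exact ⟨(lt_min (half_pos (add_pos hρ hρ'))
        (mean_add_flux_pos hρ hρ' hU hstd hV)).trans_le hq1.1,
      (lt_min (half_pos (add_pos hz hz'))
        (mean_add_flux_pos hz hz' hU hstd hV)).trans_le hq2.1⟩
  · rw [SGLF_fst hα0]
    exact add_div_mem_Icc_min_max hstd hα
  · rw [SGLF_snd_snd hα0]
    exact add_div_mem_Icc_min_max hstd hα

lemma SGLF_mem_admissible {α : ℝ} {U V : ℝ × ℝ × ℝ} (hv : 0 < vref) (hγ : 0 ≤ γ)
    (hκ : γ + 1 ≤ κ) (hvmin : 0 ≤ vmin)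
    (hU : U ∈ admissible vref γ κ vmin wmin wmax cmin cmax)
    (hV : V ∈ admissible vref γ κ vmin wmin wmax cmin cmax)
    (hα : amax vref γ κ U V < α) :
    SGLF vref γ κ α U V ∈ admissible vref γ κ vmin wmin wmax cmin cmax := by
  have hUmem := hU
  have hVmem := hV
  obtain ⟨hρ, hz, -, -, hvel, -, -⟩ := hU
  obtain ⟨hρ', hz', -, -, hvel', -, -⟩ := hV
  obtain ⟨hstd, hα1⟩ := max_lt_iff.mp hα
  have hspeed := (max_lt_iff.mp hα1).1
  have hVstd : vel vref γ κ V < astd vref γ κ U V :=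
    (vel_lt_abar hv hγ hρ' hz').trans_le (le_max_right _ _)
  have hstd0 : 0 < astd vref γ κ U V := (hvmin.trans hvel').trans_lt hVstd
  have hα0 : 0 < α := hstd0.trans hstd
  have hU0 := hvmin.trans hvel
  have hVα : vel vref γ κ V / α < 1 := (div_lt_one hα0).mpr (hVstd.trans hstd)
  have hUα : 0 ≤ vel vref γ κ U / α := div_nonneg hU0 hα0.le
  have hsα : sfun vref γ κ (SGLF vref γ κ α U V).1 (SGLF vref γ κ α U V).2.2 ≤ U.1 * α := by
    have h : sbar vref γ κ U V / U.1 ≤ α := by linarith [abs_nonneg (vel vref γ κ U)]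
    rw [div_le_iff₀ hρ] at h
    linarith [sfun_SGLF_le_sbar hρ hz hρ' hz' hU0 hstd0 hVstd hstd.le]
  rw [SGLF_eq_smul_add_smul] at hsα ⊢
  refine smul_add_smul_mem_admissible hUmem hVmem (by linarith) (by linarith) fun hSρ hSz => ?_
  have h1 := mul_vel_sub_le_dot3 (vmin := vmin) hv hγ hκ hρ hz hSρ hSz
  have h2 := mul_vel_sub_le_dot3 (vmin := vmin) hv hγ hκ hρ' hz' hSρ hSz
  have hs := sfun_pos (κ := κ) hv hγ hSρ hSz
  rw [dot3_smul_add_smul]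
  generalize nvec vref γ κ vmin _ _ = n at *
  generalize sfun vref γ κ _ _ = s at *
  generalize vel vref γ κ U = va at *
  generalize vel vref γ κ V = vb at *
  have hV0 : 0 ≤ (1 - vb / α) / 2 * (dot3 V n + s) :=
    mul_nonneg (by linarith) ((mul_nonneg hρ'.le (sub_nonneg.mpr hvel')).trans h2)
  have hU1 : 1 / 2 * (U.1 * (va - vmin)) ≤ (1 + va / α) / 2 * (dot3 U n + s) :=
    mul_le_mul (by linarith) h1 (mul_nonneg hρ.le (sub_nonneg.mpr hvel)) (by linarith)
  have hloss : s * (va - vb) / α ≤ U.1 * (va - vmin) := by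
    rw [div_le_iff₀ hα0]
    linear_combination mul_nonneg hs.le (sub_nonneg.mpr hvel') +
      mul_le_mul_of_nonneg_right hsα (sub_nonneg.mpr hvel)
  linear_combination hV0 + hU1 + hloss / 2

end Admissible

/-- Moving the states at two indices `i`, `j` towards points of a convex set keeps a weighted
average inside it. -/
lemma Convex.sum_smul_add_add_mem {E ι : Type*} [AddCommGroup E] [Module ℝ E] [Fintype ι]
    {s : Set E} (hs : Convex ℝ s) {ω : ι → ℝ} {u : ι → E} {x y : E} {i j : ι} {c : ℝ}
    (hω : ∀ k, 0 < ω k) (hsum : ∑ k, ω k = 1) (hu : ∀ k, u k ∈ s) (hx : x ∈ s) (hy : y ∈ s)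
    (hij : i ≠ j) (hc : 0 ≤ c) (hci : c ≤ ω i) (hcj : c ≤ ω j) :
    ∑ k, ω k • u k + c • (x - u i) + c • (y - u j) ∈ s := by
  classical
  have hmove {z : E} {k : ι} (hz : z ∈ s) (hck : c ≤ ω k) : u k + (c / ω k) • (z - u k) ∈ s :=
    hs.add_smul_sub_mem (hu k) hz ⟨div_nonneg hc (hω k).le, (div_le_one (hω k)).mpr hck⟩
  have key : ∑ k, ω k • u k + c • (x - u i) + c • (y - u j) =
      ∑ k, ω k • (u k + (if k = i then (c / ω i) • (x - u i) else 0)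
        + (if k = j then (c / ω j) • (y - u j) else 0)) := by
    simp only [smul_add, Finset.sum_add_distrib, smul_ite, smul_zero, Finset.sum_ite_eq',
      Finset.mem_univ, if_true, smul_smul, mul_div_cancel₀ _ (hω _).ne']
  rw [key]
  refine hs.sum_mem (fun k _ => (hω k).le) hsum fun k _ => ?_
  by_cases hki : k = i
  · subst hki
    simpa [hij] using hmove hx hci
  · by_cases hkj : k = j
    · subst hkj
      simpa [hki] using hmove hy hcj
    · simpa [hki, hkj] using hu k

theorem stmt_13 (vref γ κ vmin wmin wmax cmin cmax : ℝ)
    (hvref : 0 < vref) (hγ : 0 ≤ γ) (hκ : γ + 1 ≤ κ) (hvmin : 0 ≤ vmin)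
    (hwb : wmin ≤ wmax) (hcb : cmin ≤ cmax)
    (L : ℕ) (hL : 2 ≤ L)
    (ω : Fin L → ℝ) (hωpos : ∀ ℓ, 0 < ω ℓ) (hωsum : ∑ ℓ, ω ℓ = 1)
    (hωsym : ω ⟨0, by omega⟩ = ω ⟨L - 1, by omega⟩)
    (Uq : Fin L → ℝ × ℝ × ℝ) (Um Up : ℝ × ℝ × ℝ)
    (hUq : ∀ ℓ, Uq ℓ ∈ {U : ℝ × ℝ × ℝ | 0 < U.1 ∧ 0 < U.2.2 ∧
        wmin ≤ U.2.1 / U.1 ∧ U.2.1 / U.1 ≤ wmax ∧ vmin ≤ vel vref γ κ U ∧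
        cmin ≤ U.2.2 / U.1 ∧ U.2.2 / U.1 ≤ cmax})
    (hUm : Um ∈ {U : ℝ × ℝ × ℝ | 0 < U.1 ∧ 0 < U.2.2 ∧
        wmin ≤ U.2.1 / U.1 ∧ U.2.1 / U.1 ≤ wmax ∧ vmin ≤ vel vref γ κ U ∧
        cmin ≤ U.2.2 / U.1 ∧ U.2.2 / U.1 ≤ cmax})
    (hUp : Up ∈ {U : ℝ × ℝ × ℝ | 0 < U.1 ∧ 0 < U.2.2 ∧
        wmin ≤ U.2.1 / U.1 ∧ U.2.1 / U.1 ≤ wmax ∧ vmin ≤ vel vref γ κ U ∧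
        cmin ≤ U.2.2 / U.1 ∧ U.2.2 / U.1 ≤ cmax})
    (Δt Δx α : ℝ) (hΔt : 0 < Δt) (hΔx : 0 < Δx) (hα0 : 0 < α)
    (hα : ∀ Ua ∈ ({Um, Uq ⟨0, by omega⟩, Uq ⟨L - 1, by omega⟩, Up} : Set (ℝ × ℝ × ℝ)),
          ∀ Ub ∈ ({Um, Uq ⟨0, by omega⟩, Uq ⟨L - 1, by omega⟩, Up} : Set (ℝ × ℝ × ℝ)),
            amax vref γ κ Ua Ub < α)
    (hCFL : α * Δt / Δx ≤ ω ⟨0, by omega⟩) :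
    (∑ ℓ, ω ℓ • Uq ℓ) + (Δt / Δx) •
        ((1 / 2 : ℝ) • (flux vref γ κ Um + flux vref γ κ (Uq ⟨0, by omega⟩) -
            α • (Uq ⟨0, by omega⟩ - Um)) -
         (1 / 2 : ℝ) • (flux vref γ κ (Uq ⟨L - 1, by omega⟩) + flux vref γ κ Up -
            α • (Up - Uq ⟨L - 1, by omega⟩))) ∈
      {U : ℝ × ℝ × ℝ | 0 < U.1 ∧ 0 < U.2.2 ∧
        wmin ≤ U.2.1 / U.1 ∧ U.2.1 / U.1 ≤ wmax ∧ vmin ≤ vel vref γ κ U ∧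
        cmin ≤ U.2.2 / U.1 ∧ U.2.2 / U.1 ≤ cmax} := by
  have hconv := convex_admissible (vmin := vmin) (wmin := wmin) (wmax := wmax) (cmin := cmin)
    (cmax := cmax) hvref hγ hκ
  have hfirst := SGLF_mem_admissible hvref hγ hκ hvmin (hUq ⟨0, by omega⟩) hUp
    (hα _ (by simp) _ (by simp))
  have hlast := SGLF_mem_admissible hvref hγ hκ hvmin hUm (hUq ⟨L - 1, by omega⟩)
    (hα _ (by simp) _ (by simp))
  have hmem := hconv.sum_smul_add_add_mem hωpos hωsum hUq hfirst hlast
    (by rw [Ne, Fin.mk.injEq]; omega) (by positivity) hCFL (hωsym ▸ hCFL)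
  refine Set.mem_of_eq_of_mem ?_ hmem
  rw [add_assoc]
  congr 1
  simp only [SGLF]
  match_scalars <;> field_simp <;> ring
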